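/- The sign-constrained log-determinant program min_{X ∈ M^p, X_{ij}=0 ∀(i,j)∈E} −log det(X) + tr(X S) + Σ_{i≠j} λ_{ij}|X_{ij}| has a unique minimizer, provided S is symmetric positive semidefinite with strictly positive diagonal and λ_{ij} > 0 off the disconnectivity set E. -/

import Mathlib

open Matrix

/-- The feasible set of the sign-constrained log-determinant program: symmetric positive
definite matrices with nonpositive off-diagonal entries vanishing on the disconnectivity
set `E`. -/
def feasible {p : ℕ} (E : Set (Fin p × Fin p)) (X : Matrix (Fin p) (Fin p) ℝ) : Prop :=
  X.PosDef ∧ (∀ i j, i ≠ j → X i j ≤ 0) ∧ (∀ i j, (i, j) ∈ E → X i j = 0)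

/-- The objective `f(X) = -log det X + tr(X S) + Σ_{i≠j} λ_{ij} |X_{ij}|`. -/
noncomputable def obj {p : ℕ} (S : Matrix (Fin p) (Fin p) ℝ) (l : Fin p → Fin p → ℝ)
    (X : Matrix (Fin p) (Fin p) ℝ) : ℝ :=
  -Real.log X.det + (X * S).trace + ∑ i, ∑ j, if i ≠ j then l i j * |X i j| else 0

open scoped MatrixOrder in
/-- A real positive semidefinite matrix is a Gram matrix. -/
theorem Matrix.PosSemidef.exists_eq_conjTranspose_mul_self {n : Type*} [Fintype n] [DecidableEq n]
    {A : Matrix n n ℝ} (hA : A.PosSemidef) : ∃ B : Matrix n n ℝ, A = Bᴴ * B := by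
  obtain ⟨B, hB⟩ := CStarAlgebra.nonneg_iff_eq_star_mul_self.mp hA.nonneg
  exact ⟨B, hB⟩

theorem Matrix.PosSemidef.trace_mul_nonneg {n : Type*} [Fintype n] [DecidableEq n]
    {A B : Matrix n n ℝ} (hA : A.PosSemidef) (hB : B.PosSemidef) : 0 ≤ (A * B).trace := by
  obtain ⟨C, rfl⟩ := hB.exists_eq_conjTranspose_mul_self
  rw [← Matrix.mul_assoc, Matrix.trace_mul_comm, ← Matrix.mul_assoc]
  exact (hA.mul_mul_conjTranspose_same C).trace_nonneg

theorem Matrix.IsHermitian.eq_one_of_eigenvalues_eq_one {n : Type*} [Fintype n] [DecidableEq n]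
    {A : Matrix n n ℝ} (hA : A.IsHermitian) (h : ∀ i, hA.eigenvalues i = 1) : A = 1 := by
  have h' : hA.eigenvalues = 1 := funext h
  rw [hA.spectral_theorem, h']
  have : diagonal ((RCLike.ofReal : ℝ → ℝ) ∘ (1 : n → ℝ)) = 1 := by
    ext i j; simp [diagonal, Matrix.one_apply]
  rw [this, map_one]

theorem Matrix.PosDef.log_det_eq_sum {n : Type*} [Fintype n] [DecidableEq n]
    {A : Matrix n n ℝ} (hA : A.PosDef) :
    Real.log A.det = ∑ i, Real.log (hA.1.eigenvalues i) := by
  rw [hA.1.det_eq_prod_eigenvalues]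
  exact Real.log_prod fun i _ => (hA.eigenvalues_pos i).ne'

theorem Matrix.PosDef.sum_eigenvalues_sub_one {n : Type*} [Fintype n] [DecidableEq n]
    {A : Matrix n n ℝ} (hA : A.PosDef) :
    ∑ i, (hA.1.eigenvalues i - 1) = A.trace - Fintype.card n := by
  rw [hA.1.trace_eq_sum_eigenvalues]
  simp

theorem Matrix.PosDef.log_det_le {n : Type*} [Fintype n] [DecidableEq n]
    {A : Matrix n n ℝ} (hA : A.PosDef) : Real.log A.det ≤ A.trace - Fintype.card n := by
  rw [hA.log_det_eq_sum, ← hA.sum_eigenvalues_sub_one]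
  exact Finset.sum_le_sum fun i _ => Real.log_le_sub_one_of_pos (hA.eigenvalues_pos i)

theorem Matrix.PosDef.log_det_lt {n : Type*} [Fintype n] [DecidableEq n]
    {A : Matrix n n ℝ} (hA : A.PosDef) (h1 : A ≠ 1) :
    Real.log A.det < A.trace - Fintype.card n := by
  rw [hA.log_det_eq_sum, ← hA.sum_eigenvalues_sub_one]
  obtain ⟨i, hi⟩ : ∃ i, hA.1.eigenvalues i ≠ 1 := by
    by_contra! h
    exact h1 (hA.1.eq_one_of_eigenvalues_eq_one h)
  exact Finset.sum_lt_sum (fun i _ => Real.log_le_sub_one_of_pos (hA.eigenvalues_pos i))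
    ⟨i, Finset.mem_univ i, Real.log_lt_sub_one_of_pos (hA.eigenvalues_pos i) hi⟩

/-- Congruence by the inverse of a square root of `M`. -/
theorem Matrix.PosDef.exists_congruence {n : Type*} [Fintype n] [DecidableEq n]
    {M : Matrix n n ℝ} (hM : M.PosDef) : ∃ C : Matrix n n ℝ, IsUnit C ∧ Cᴴ * M * C = 1 := by
  obtain ⟨B, hB⟩ := hM.posSemidef.exists_eq_conjTranspose_mul_self
  have hdet : B.det ≠ 0 := by
    intro h
    have := hM.det_pos
    rw [hB, Matrix.det_mul, h, mul_zero] at this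
    exact lt_irrefl _ this
  have hu : IsUnit B.det := isUnit_iff_ne_zero.mpr hdet
  refine ⟨B⁻¹, (Matrix.isUnit_nonsing_inv_iff).mpr ((Matrix.isUnit_iff_isUnit_det B).mpr hu), ?_⟩
  rw [hB, Matrix.mul_assoc, Matrix.mul_assoc, Matrix.mul_nonsing_inv _ hu, Matrix.mul_one,
    ← Matrix.conjTranspose_mul, Matrix.mul_nonsing_inv _ hu, Matrix.conjTranspose_one]

/-- Strict midpoint concavity of the log-determinant. -/
theorem Matrix.PosDef.log_det_add_log_det_lt {n : Type*} [Fintype n] [DecidableEq n]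
    {X Y : Matrix n n ℝ} (hX : X.PosDef) (hY : Y.PosDef) (hXY : X ≠ Y) :
    Real.log X.det + Real.log Y.det < 2 * Real.log ((1 / 2 : ℝ) • (X + Y)).det := by
  set M := (1 / 2 : ℝ) • (X + Y) with hMdef
  have hM : M.PosDef := (hX.add hY).smul (by norm_num)
  obtain ⟨C, hC, hCM⟩ := hM.exists_congruence
  have hinj := Matrix.mulVec_injective_of_isUnit hC
  have hX' := hX.conjTranspose_mul_mul_same hinj
  have hY' := hY.conjTranspose_mul_mul_same hinj
  have hlog : ∀ Z : Matrix n n ℝ, Z.PosDef →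
      Real.log (Cᴴ * Z * C).det = Real.log Z.det - Real.log M.det := by
    intro Z hZ
    have h1 : C.det * M.det * C.det = 1 := by
      have := congrArg Matrix.det hCM
      simpa using this
    have h2 : (Cᴴ * Z * C).det = Z.det / M.det := by
      rw [eq_div_iff hM.det_pos.ne']
      simp only [Matrix.det_mul, Matrix.det_conjTranspose, star_trivial]
      linear_combination Z.det * h1
    rw [h2, Real.log_div hZ.det_pos.ne' hM.det_pos.ne']
  have hne : Cᴴ * X * C ≠ 1 := by
    intro h
    have hXM : X = M := by
      rw [← hCM] at h
      exact (hC.star.mul_left_cancel (hC.mul_right_cancel h))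
    apply hXY
    have h2 : (2 : ℝ) • X = X + Y := by
      refine (congrArg ((2 : ℝ) • ·) (hXM.trans hMdef)).trans ?_
      simp only [smul_smul, mul_one_div_cancel (two_ne_zero' ℝ), one_smul]
    rw [two_smul] at h2
    exact add_left_cancel h2
  have htr : (Cᴴ * X * C).trace + (Cᴴ * Y * C).trace = 2 * Fintype.card n := by
    have : Cᴴ * X * C + Cᴴ * Y * C = (2 : ℝ) • (Cᴴ * M * C) := by
      rw [hMdef, Matrix.mul_smul, Matrix.smul_mul, smul_smul, Matrix.mul_add, Matrix.add_mul]
      norm_num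
    rw [← Matrix.trace_add, this, hCM, Matrix.trace_smul, Matrix.trace_one, smul_eq_mul]
  have h1 := hX'.log_det_lt hne
  have h2 := hY'.log_det_le
  rw [hlog X hX] at h1
  rw [hlog Y hY] at h2
  linarith

theorem Matrix.isClosed_setOf_posSemidef {n : Type*} [Fintype n] :
    IsClosed {A : Matrix n n ℝ | A.PosSemidef} := by
  simp only [Matrix.posSemidef_iff_dotProduct_mulVec, Set.ofPred_and, Set.ofPred_forall,
    Matrix.IsHermitian]
  refine (isClosed_eq (by fun_prop) (by fun_prop)).inter (isClosed_iInter fun x => ?_)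
  exact isClosed_le (by fun_prop) (by fun_prop)

/-- The part `tr(X S) + Σ_{i≠j} λ_{ij} |X_{ij}|` of the objective, linear on the
feasible cone. -/
noncomputable def penalty {p : ℕ} (S : Matrix (Fin p) (Fin p) ℝ) (l : Fin p → Fin p → ℝ)
    (X : Matrix (Fin p) (Fin p) ℝ) : ℝ :=
  (X * S).trace + ∑ i, ∑ j, if i ≠ j then l i j * |X i j| else 0

/-- The closed cone of positive semidefinite matrices with the sign and sparsity pattern of the
feasible set. -/
def feasibleCone {p : ℕ} (E : Set (Fin p × Fin p)) : Set (Matrix (Fin p) (Fin p) ℝ) :=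
  {X | X.PosSemidef ∧ (∀ i j, i ≠ j → X i j ≤ 0) ∧ (∀ i j, (i, j) ∈ E → X i j = 0)}

section Program

variable {p : ℕ} {S : Matrix (Fin p) (Fin p) ℝ} {E : Set (Fin p × Fin p)} {l : Fin p → Fin p → ℝ}

theorem obj_eq (S : Matrix (Fin p) (Fin p) ℝ) (l : Fin p → Fin p → ℝ)
    (X : Matrix (Fin p) (Fin p) ℝ) : obj S l X = -Real.log X.det + penalty S l X := by
  rw [obj, penalty, add_assoc]

theorem continuous_penalty (S : Matrix (Fin p) (Fin p) ℝ) (l : Fin p → Fin p → ℝ) :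
    Continuous (penalty S l) := by
  unfold penalty
  refine Continuous.add (by fun_prop) ?_
  refine continuous_finsetSum _ fun i _ => continuous_finsetSum _ fun j _ => ?_
  split_ifs <;> fun_prop

theorem penalty_smul {a : ℝ} (ha : 0 ≤ a) (X : Matrix (Fin p) (Fin p) ℝ) :
    penalty S l (a • X) = a * penalty S l X := by
  simp only [penalty, Matrix.smul_mul, Matrix.trace_smul, smul_eq_mul, Matrix.smul_apply, abs_mul,
    abs_of_nonneg ha, mul_add, Finset.mul_sum, mul_ite, mul_zero, mul_left_comm a]

theorem isClosed_feasibleCone (E : Set (Fin p × Fin p)) : IsClosed (feasibleCone E) := by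
  simp only [feasibleCone, Set.ofPred_and, Set.ofPred_forall]
  refine Matrix.isClosed_setOf_posSemidef.inter (IsClosed.inter ?_ ?_)
  · exact isClosed_iInter fun i => isClosed_iInter fun j => isClosed_iInter fun _ =>
      isClosed_le (by fun_prop) (by fun_prop)
  · exact isClosed_iInter fun i => isClosed_iInter fun j => isClosed_iInter fun _ =>
      isClosed_eq (by fun_prop) (by fun_prop)

theorem smul_mem_feasibleCone {a : ℝ} (ha : 0 ≤ a) {X : Matrix (Fin p) (Fin p) ℝ}
    (hX : X ∈ feasibleCone E) : a • X ∈ feasibleCone E := by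
  refine ⟨hX.1.smul ha, fun i j hij => ?_, fun i j hij => ?_⟩
  · simpa using mul_nonpos_of_nonneg_of_nonpos ha (hX.2.1 i j hij)
  · simp [hX.2.2 i j hij]

theorem feasible.mem_feasibleCone {X : Matrix (Fin p) (Fin p) ℝ} (hX : feasible E X) :
    X ∈ feasibleCone E :=
  ⟨hX.1.posSemidef, hX.2⟩

theorem feasible_of_mem_feasibleCone {X : Matrix (Fin p) (Fin p) ℝ} (hX : X ∈ feasibleCone E)
    (hdet : X.det ≠ 0) : feasible E X :=
  ⟨hX.1.posDef_iff_det_ne_zero.mpr hdet, hX.2⟩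

theorem feasible_one (hE : ∀ ij ∈ E, ij.1 ≠ ij.2) : feasible E 1 := by
  refine ⟨Matrix.PosDef.one, fun i j hij => ?_, fun i j hij => ?_⟩
  · rw [Matrix.one_apply_ne hij]
  · exact Matrix.one_apply_ne (hE _ hij)

theorem feasible.midpoint {X Y : Matrix (Fin p) (Fin p) ℝ} (hX : feasible E X)
    (hY : feasible E Y) : feasible E ((1 / 2 : ℝ) • (X + Y)) := by
  refine ⟨(hX.1.add hY.1).smul (by norm_num), fun i j hij => ?_, fun i j hij => ?_⟩
  · have h1 := hX.2.1 i j hij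
    have h2 := hY.2.1 i j hij
    simp only [Matrix.smul_apply, Matrix.add_apply, smul_eq_mul]
    linarith
  · simp [hX.2.2 i j hij, hY.2.2 i j hij]

/-- On matrices with nonpositive off-diagonal entries the penalty is additive. -/
theorem penalty_add {X Y : Matrix (Fin p) (Fin p) ℝ} (hX : ∀ i j, i ≠ j → X i j ≤ 0)
    (hY : ∀ i j, i ≠ j → Y i j ≤ 0) :
    penalty S l (X + Y) = penalty S l X + penalty S l Y := by
  have : ∀ i j, (if i ≠ j then l i j * |(X + Y) i j| else 0) =
      (if i ≠ j then l i j * |X i j| else 0) + (if i ≠ j then l i j * |Y i j| else 0) := by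
    intro i j
    by_cases hij : i = j
    · simp [hij]
    · simp only [ne_eq, hij, not_false_eq_true, if_true, Matrix.add_apply]
      rw [abs_of_nonpos (hX i j hij), abs_of_nonpos (hY i j hij),
        abs_of_nonpos (add_nonpos (hX i j hij) (hY i j hij))]
      ring
  simp only [penalty, this, Finset.sum_add_distrib, Matrix.add_mul, Matrix.trace_add]
  ring

theorem penalty_pos (hS : S.PosSemidef) (hSdiag : ∀ i, 0 < S i i)
    (hl : ∀ i j, i ≠ j → (i, j) ∉ E → 0 < l i j) {X : Matrix (Fin p) (Fin p) ℝ}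
    (hX : X ∈ feasibleCone E) (hX0 : X ≠ 0) : 0 < penalty S l X := by
  have hterm : ∀ i j, 0 ≤ if i ≠ j then l i j * |X i j| else 0 := by
    intro i j
    split_ifs with hij
    · by_cases hE : (i, j) ∈ E
      · simp [hX.2.2 i j hE]
      · exact mul_nonneg (hl i j hij hE).le (abs_nonneg _)
    · exact le_rfl
  have htr := hX.1.trace_mul_nonneg hS
  by_cases hdiag : ∀ i j, i ≠ j → X i j = 0
  · have htr' : (X * S).trace = ∑ i, X i i * S i i := by
      simp only [Matrix.trace, Matrix.diag, Matrix.mul_apply]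
      refine Finset.sum_congr rfl fun i _ => Finset.sum_eq_single i (fun j _ hj => ?_) (by simp)
      rw [hdiag i j hj.symm, zero_mul]
    obtain ⟨i, hi⟩ : ∃ i, X i i ≠ 0 := by
      by_contra! h
      refine hX0 (Matrix.ext fun i j => ?_)
      by_cases hij : i = j
      · simpa [hij] using h j
      · simpa using hdiag i j hij
    refine add_pos_of_pos_of_nonneg ?_
      (Finset.sum_nonneg fun i _ => Finset.sum_nonneg fun j _ => hterm i j)
    rw [htr']
    exact Finset.sum_pos' (fun j _ => mul_nonneg hX.1.diag_nonneg (hSdiag j).le)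
      ⟨i, Finset.mem_univ i, mul_pos (lt_of_le_of_ne hX.1.diag_nonneg hi.symm) (hSdiag i)⟩
  · push Not at hdiag
    obtain ⟨i, j, hij, hne⟩ := hdiag
    refine add_pos_of_nonneg_of_pos htr ?_
    refine Finset.sum_pos' (fun i _ => Finset.sum_nonneg fun j _ => hterm i j)
      ⟨i, Finset.mem_univ i, Finset.sum_pos' (fun j _ => hterm i j) ⟨j, Finset.mem_univ j, ?_⟩⟩
    rw [if_pos hij]
    exact mul_pos (hl i j hij fun h => hne (hX.2.2 i j h)) (abs_pos.mpr hne)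

attribute [local instance] Matrix.normedAddCommGroup Matrix.normedSpace

theorem exists_pos_mul_norm_le_penalty (hS : S.PosSemidef) (hSdiag : ∀ i, 0 < S i i)
    (hl : ∀ i j, i ≠ j → (i, j) ∉ E → 0 < l i j) :
    ∃ c : ℝ, 0 < c ∧ ∀ X ∈ feasibleCone E, c * ‖X‖ ≤ penalty S l X := by
  have : ProperSpace (Matrix (Fin p) (Fin p) ℝ) := FiniteDimensional.proper ℝ _
  set K := Metric.sphere (0 : Matrix (Fin p) (Fin p) ℝ) 1 ∩ feasibleCone E with hK
  have hKc : IsCompact K := (isCompact_sphere _ _).inter_right (isClosed_feasibleCone E)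
  have hlow : ∃ c : ℝ, 0 < c ∧ ∀ X ∈ K, c ≤ penalty S l X := by
    rcases K.eq_empty_or_nonempty with h | h
    · exact ⟨1, one_pos, by simp [h]⟩
    · obtain ⟨X, hX, hmin⟩ := hKc.exists_isMinOn h (continuous_penalty S l).continuousOn
      refine ⟨penalty S l X, penalty_pos hS hSdiag hl hX.2 ?_, fun Y hY => hmin hY⟩
      rintro rfl
      simpa using hX.1
  obtain ⟨c, hc, hcK⟩ := hlow
  refine ⟨c, hc, fun X hX => ?_⟩
  by_cases hX0 : X = 0
  · have := penalty_smul (S := S) (l := l) le_rfl X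
    simp only [zero_smul, zero_mul] at this
    simp [hX0, this]
  · have hn : 0 < ‖X‖ := norm_pos_iff.mpr hX0
    have hmem : ‖X‖⁻¹ • X ∈ K := by
      refine ⟨?_, smul_mem_feasibleCone (inv_nonneg.mpr hn.le) hX⟩
      rw [mem_sphere_zero_iff_norm, norm_smul, norm_inv, norm_norm, inv_mul_cancel₀ hn.ne']
    have := hcK _ hmem
    rw [penalty_smul (inv_nonneg.mpr hn.le), inv_mul_eq_div, le_div_iff₀ hn] at this
    exact this

theorem exists_feasible_isMinOn (hS : S.PosSemidef) (hSdiag : ∀ i, 0 < S i i)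
    (hE : ∀ ij ∈ E, ij.1 ≠ ij.2) (hl : ∀ i j, i ≠ j → (i, j) ∉ E → 0 < l i j) :
    ∃ X, feasible E X ∧ ∀ Y, feasible E Y → obj S l X ≤ obj S l Y := by
  have : ProperSpace (Matrix (Fin p) (Fin p) ℝ) := FiniteDimensional.proper ℝ _
  obtain ⟨c, hc, hcoer⟩ := exists_pos_mul_norm_le_penalty hS hSdiag hl
  set h : Matrix (Fin p) (Fin p) ℝ → ℝ := fun X => X.det * Real.exp (-penalty S l X) with hh
  have hcont : Continuous h :=
    (by fun_prop : Continuous fun X : Matrix (Fin p) (Fin p) ℝ => X.det).mul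
      (Real.continuous_exp.comp (continuous_penalty S l).neg)
  have hone : 0 < h 1 := by simp [hh, Real.exp_pos]
  have hlim : Filter.Tendsto (fun x : ℝ => (p.factorial : ℝ) * (x ^ p * Real.exp (-c * x)))
      Filter.atTop (nhds 0) := by
    simpa using (tendsto_rpow_mul_exp_neg_mul_atTop_nhds_zero p c hc).const_mul (p.factorial : ℝ)
  have hev :
      ∀ᶠ X in Filter.cocompact (Matrix (Fin p) (Fin p) ℝ) ⊓ Filter.principal (feasibleCone E),
        h X ≤ h 1 := by
    rw [Filter.eventually_inf_principal]
    have := (hlim.comp (tendsto_norm_cocompact_atTop (E := Matrix (Fin p) (Fin p) ℝ))).eventually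
      (gt_mem_nhds hone)
    filter_upwards [this] with X hX hXC
    refine le_trans ?_ hX.le
    have hdet : X.det ≤ p.factorial * ‖X‖ ^ p := by
      have := Matrix.det_le (A := X) (abv := AbsoluteValue.abs) (x := ‖X‖)
        fun i j => Matrix.norm_entry_le_entrywise_sup_norm X
      rw [Fintype.card_fin, nsmul_eq_mul] at this
      exact (le_abs_self _).trans this
    have hexp : Real.exp (-penalty S l X) ≤ Real.exp (-c * ‖X‖) :=
      Real.exp_le_exp.mpr (by linarith [hcoer X hXC])
    simp only [Function.comp_apply, ← mul_assoc]
    exact mul_le_mul hdet hexp (Real.exp_pos _).le (by positivity)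
  obtain ⟨X, hXC, hmax⟩ := hcont.continuousOn.exists_isMaxOn' (isClosed_feasibleCone E)
    (feasible_one hE).mem_feasibleCone hev
  have hXpos : 0 < h X := hone.trans_le (hmax (feasible_one hE).mem_feasibleCone)
  have hX : feasible E X := feasible_of_mem_feasibleCone hXC (left_ne_zero_of_mul hXpos.ne')
  have hobj : ∀ Z, feasible E Z → obj S l Z = -Real.log (h Z) := by
    intro Z hZ
    rw [obj_eq, hh, Real.log_mul hZ.1.det_pos.ne' (Real.exp_pos _).ne', Real.log_exp]
    ring
  refine ⟨X, hX, fun Y hY => ?_⟩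
  rw [hobj X hX, hobj Y hY, neg_le_neg_iff]
  exact Real.log_le_log (mul_pos hY.1.det_pos (Real.exp_pos _)) (hmax hY.mem_feasibleCone)

theorem obj_midpoint_lt {X Y : Matrix (Fin p) (Fin p) ℝ} (hX : feasible E X) (hY : feasible E Y)
    (hXY : X ≠ Y) : 2 * obj S l ((1 / 2 : ℝ) • (X + Y)) < obj S l X + obj S l Y := by
  have h := hX.1.log_det_add_log_det_lt hY.1 hXY
  simp only [obj_eq, penalty_smul (by norm_num : (0 : ℝ) ≤ 1 / 2), penalty_add hX.2.1 hY.2.1]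
  linarith

end Program

/-- The sign-constrained log-determinant program
`min_{X ∈ M^p, X_{ij}=0 ∀(i,j)∈E} −log det X + tr(X S) + Σ_{i≠j} λ_{ij}|X_{ij}|`
has a unique minimizer, provided `S` is symmetric positive semidefinite with strictly
positive diagonal and `λ_{ij} > 0` off the disconnectivity set `E`. -/
theorem stmt_9 {p : ℕ} (S : Matrix (Fin p) (Fin p) ℝ) (hS : S.PosSemidef)
    (hSdiag : ∀ i, 0 < S i i)
    (E : Set (Fin p × Fin p)) (hE : ∀ ij ∈ E, ij.1 ≠ ij.2)
    (l : Fin p → Fin p → ℝ) (hl : ∀ i j, i ≠ j → (i, j) ∉ E → 0 < l i j) :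
    ∃! X : Matrix (Fin p) (Fin p) ℝ,
      feasible E X ∧ ∀ Y, feasible E Y → obj S l X ≤ obj S l Y := by
  obtain ⟨X, hX, hmin⟩ := exists_feasible_isMinOn hS hSdiag hE hl
  refine ⟨X, ⟨hX, hmin⟩, fun Y ⟨hY, hYmin⟩ => ?_⟩
  by_contra hne
  have hlt := obj_midpoint_lt (S := S) (l := l) hY hX hne
  have h1 := hmin _ (hY.midpoint hX)
  have h2 := hYmin _ (hY.midpoint hX)
  linarith
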